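/- Let Δx > 0, x_m = m·Δx, and let h : ℝ → ℝ be a polynomial of degree at most 2. Let f_m = (1/Δx)·∫_{x_m−Δx/2}^{x_m+Δx/2} h(ξ) dξ denote the cell average of h over cell m. Then for every integer i, (2/6)·f_{i−2} − (7/6)·f_{i−1} + (11/6)·f_i = h(x_i + Δx/2). (Exactness of the fully upwind candidate stencil flux k = 2 of Table 1.) -/

import Mathlib

theorem integral_quadratic (a b c u v : ℝ) :
    ∫ ξ in u..v, (a * ξ ^ 2 + b * ξ + c) =
      a * ((v ^ 3 - u ^ 3) / 3) + b * ((v ^ 2 - u ^ 2) / 2) + c * (v - u) := by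
  rw [intervalIntegral.integral_add, intervalIntegral.integral_add,
    intervalIntegral.integral_const_mul, intervalIntegral.integral_const_mul, integral_pow,
    integral_id, intervalIntegral.integral_const, smul_eq_mul]
  · norm_num
    ring
  all_goals exact Continuous.intervalIntegrable (by fun_prop) _ _

/-- Exactness of a candidate stencil flux of Table 1: for a polynomial of
degree at most 2, the stencil combination of cell averages recovers the
point value of the polynomial at the cell interface `x_i + Δx/2`. -/
theorem stencil_k2_exact (Δx : ℝ) (hΔx : 0 < Δx) (h : Polynomial ℝ)
    (hdeg : h.degree ≤ 2)
    (f : ℤ → ℝ)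
    (hf : ∀ m : ℤ, f m =
      (1 / Δx) * ∫ ξ in ((m : ℝ) * Δx - Δx / 2)..((m : ℝ) * Δx + Δx / 2), h.eval ξ)
    (i : ℤ) :
    (2 / 6) * f (i - 2) - (7 / 6) * f (i - 1) + (11 / 6) * f i = h.eval ((i : ℝ) * Δx + Δx / 2) := by
  have heval (x : ℝ) : h.eval x = h.coeff 2 * x ^ 2 + h.coeff 1 * x + h.coeff 0 := by
    conv_lhs => rw [Polynomial.eq_quadratic_of_degree_le_two hdeg]
    simp
  simp only [hf, heval, integral_quadratic]
  push_cast
  field_simp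
  ring
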